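/- arXiv:math-ph/9812010 — 2 statements merged into one kernel-verified Lean document; each statement's English description precedes it below -/
import Mathlib

section
/- Let Γ¹, …, Γ^{m−1} be skew-Hermitian N×N complex matrices and Π a Hermitian N×N matrix with Π² = Π and ΠΓʲ = ΓʲΠ = 0 for all j. Suppose there exist ζ₀ ∈ ℝ^{m−1} with ζ₀ ≠ 0, a real number h ≥ |ζ₀|, and a nonzero χ ∈ ℂ^N with i(Γ·ζ₀)χ = h·χ. Then Πχ = 0, and the function φ(r) := e^{−hr}·χ is a nonzero solution of −φ''(r) + |ζ₀|²·φ(r) = λ·φ(r) with λ := |ζ₀|² − h² ≤ 0, satisfying φ(r) → 0 as r → ∞ together with the homogeneous model Gilkey–Smith boundary conditions Π φ(0) = 0 and (I−Π)(φ'(0) + i(Γ·ζ₀)φ(0)) = 0. -/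
open scoped Matrix
open Filter

/-- The derivative of the vector-valued exponential `r ↦ e^{cr} v` of a real variable. -/
theorem hasDerivAt_cexp_mul_smul {E : Type*} [NormedAddCommGroup E] [NormedSpace ℂ E]
    (c : ℂ) (v : E) (r : ℝ) :
    HasDerivAt (fun r : ℝ => Complex.exp (c * r) • v) (Complex.exp (c * r) • c • v) r := by
  have hlin : HasDerivAt (fun r : ℝ => c * (r : ℂ)) c r := by
    simpa using (Complex.ofRealCLM.hasDerivAt (x := r)).const_mul c
  simpa [mul_smul] using hlin.cexp.smul_const v

theorem deriv_cexp_mul_smul {E : Type*} [NormedAddCommGroup E] [NormedSpace ℂ E]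
    (c : ℂ) (v : E) :
    deriv (fun r : ℝ => Complex.exp (c * r) • v) = fun r : ℝ => Complex.exp (c * r) • c • v :=
  funext fun r => (hasDerivAt_cexp_mul_smul c v r).deriv

/-- The vector-valued exponential `r ↦ e^{cr} v` decays at infinity when `c.re < 0`. -/
theorem tendsto_cexp_mul_smul_atTop {E : Type*} [NormedAddCommGroup E] [NormedSpace ℂ E]
    {c : ℂ} (hc : c.re < 0) (v : E) :
    Tendsto (fun r : ℝ => Complex.exp (c * r) • v) atTop (nhds 0) := by
  have hre : Tendsto (fun r : ℝ => (c * r).re) atTop atBot := by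
    simpa using tendsto_id.const_mul_atTop_of_neg hc
  simpa using (Complex.tendsto_exp_comap_re_atBot.comp (tendsto_comap_iff.2 hre)).smul_const v

/-- An eigenvector of `A` with nonzero eigenvalue is annihilated by every left annihilator
of `A`. -/
theorem Matrix.mulVec_eq_zero_of_mul_eq_zero {n K : Type*} [Fintype n] [Field K]
    {A P : Matrix n n K} {v : n → K} {c : K} (hPA : P * A = 0) (hc : c ≠ 0)
    (hv : A *ᵥ v = c • v) : P *ᵥ v = 0 := by
  have hcPv : c • P *ᵥ v = 0 := by
    rw [← Matrix.mulVec_smul, ← hv, Matrix.mulVec_mulVec, hPA, Matrix.zero_mulVec]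
  exact (smul_eq_zero.1 hcPv).resolve_left hc

/-- Failure of the positivity condition of Theorem 1 produces a nontrivial decaying
solution of the model Gilkey–Smith boundary-value problem with `λ = |ζ₀|² - h² ≤ 0`. -/
theorem stmt3 (m N : ℕ) (hm : 2 ≤ m) (hN : 1 ≤ N)
    (Γ : Fin (m - 1) → Matrix (Fin N) (Fin N) ℂ)
    (hskew : ∀ j, (Γ j)ᴴ = -Γ j)
    (P : Matrix (Fin N) (Fin N) ℂ) (hPherm : Pᴴ = P) (hPproj : P * P = P)
    (hPΓ : ∀ j, P * Γ j = 0) (hΓP : ∀ j, Γ j * P = 0)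
    (ζ₀ : EuclideanSpace ℝ (Fin (m - 1))) (hζ₀ : ζ₀ ≠ 0)
    (h : ℝ) (hh : ‖ζ₀‖ ≤ h)
    (χ : Fin N → ℂ) (hχ : χ ≠ 0)
    (heig : (Complex.I • ∑ j, (ζ₀ j : ℂ) • Γ j) *ᵥ χ = (h : ℂ) • χ) :
    P *ᵥ χ = 0 ∧
    (fun r : ℝ => Complex.exp (-(h : ℂ) * r) • χ) 0 ≠ 0 ∧
    ((‖ζ₀‖ ^ 2 - h ^ 2 : ℝ) ≤ 0) ∧
    (∀ r : ℝ,
      -(deriv (deriv (fun r' : ℝ => Complex.exp (-(h : ℂ) * r') • χ)) r) +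
        ((‖ζ₀‖ ^ 2 : ℝ) : ℂ) • Complex.exp (-(h : ℂ) * r) • χ =
      ((‖ζ₀‖ ^ 2 - h ^ 2 : ℝ) : ℂ) • Complex.exp (-(h : ℂ) * r) • χ) ∧
    Tendsto (fun r : ℝ => Complex.exp (-(h : ℂ) * r) • χ) atTop (nhds 0) ∧
    P *ᵥ ((fun r : ℝ => Complex.exp (-(h : ℂ) * r) • χ) 0) = 0 ∧
    (1 - P) *ᵥ
      (deriv (fun r' : ℝ => Complex.exp (-(h : ℂ) * r') • χ) 0 +
        (Complex.I • ∑ j, (ζ₀ j : ℂ) • Γ j) *ᵥ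
          ((fun r : ℝ => Complex.exp (-(h : ℂ) * r) • χ) 0)) = 0 := by
  have hpos : 0 < h := (norm_pos_iff.2 hζ₀).trans_le hh
  have hPχ : P *ᵥ χ = 0 :=
    Matrix.mulVec_eq_zero_of_mul_eq_zero (by simp [Matrix.mul_sum, hPΓ])
      (Complex.ofReal_ne_zero.2 hpos.ne') heig
  refine ⟨hPχ, by simpa using hχ, ?_, fun r => ?_, ?_, by simpa using hPχ, ?_⟩
  · have := pow_le_pow_left₀ (norm_nonneg ζ₀) hh 2
    linarith
  · rw [deriv_cexp_mul_smul, deriv_cexp_mul_smul]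
    push_cast
    module
  · exact tendsto_cexp_mul_smul_atTop (by simpa using hpos) χ
  · simp only [deriv_cexp_mul_smul, Complex.ofReal_zero, mul_zero, Complex.exp_zero, one_smul,
      heig]
    simp
end

section
/- Let G and V be finite-dimensional complex inner product spaces, ν : G → V a linear map with ν*ν = id_G, and μ¹, …, μ^{m−1} : G → V linear maps satisfying ν*μʲ + (μʲ)*ν = 0 for each j. Define Π := id_V − ν∘ν* and Γʲ := −ν ∘ ν* ∘ μʲ ∘ ν*. Then for every ζ ∈ ℝ^{m−1}, writing Γ·ζ := Σⱼ ζⱼ Γʲ and μ·ζ := Σⱼ ζⱼ μʲ and |ζ| for the Euclidean norm: |ζ|²·id_V + (Γ·ζ)² = |ζ|²·Π + (id_V − Π) ∘ (|ζ|²·id_V − (μ·ζ)∘(μ·ζ)*) ∘ (id_V − Π). -/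
open ContinuousLinearMap

/-- The relation `ν*μ + μ*ν = 0` is inherited by real linear combinations of the `μ j`. -/
theorem adjoint_comp_real_sum_add_eq_zero {ι G V : Type*} [Fintype ι]
    [NormedAddCommGroup G] [InnerProductSpace ℂ G] [CompleteSpace G]
    [NormedAddCommGroup V] [InnerProductSpace ℂ V] [CompleteSpace V]
    (ν : G →L[ℂ] V) (μ : ι → (G →L[ℂ] V))
    (hμ : ∀ j, adjoint ν ∘L μ j + adjoint (μ j) ∘L ν = 0) (ζ : ι → ℝ) :
    adjoint ν ∘L (∑ j, (ζ j : ℂ) • μ j) + adjoint (∑ j, (ζ j : ℂ) • μ j) ∘L ν = 0 := by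
  have hadj : adjoint (∑ j, (ζ j : ℂ) • μ j) = ∑ j, (ζ j : ℂ) • adjoint (μ j) := by
    simp only [map_sum, map_smulₛₗ, Complex.conj_ofReal]
  rw [hadj, comp_finsetSum, finsetSum_comp, ← Finset.sum_add_distrib]
  refine Finset.sum_eq_zero fun j _ => ?_
  rw [comp_smul, smul_comp, ← smul_add, hμ j, smul_zero]

/-- Formula (84) of the paper: with `Π = id_V - νν*` and `Γʲ = -νν*μʲν*`,
for every `ζ ∈ ℝ^{m-1}`,
`|ζ|²·id + (Γ·ζ)² = |ζ|²·Π + (id-Π)(|ζ|²·id - (μ·ζ)(μ·ζ)*)(id-Π)`. -/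
theorem stmt17 (m : ℕ) (G V : Type*)
    [NormedAddCommGroup G] [InnerProductSpace ℂ G] [FiniteDimensional ℂ G]
    [NormedAddCommGroup V] [InnerProductSpace ℂ V] [FiniteDimensional ℂ V]
    (ν : G →L[ℂ] V) (hν : adjoint ν ∘L ν = ContinuousLinearMap.id ℂ G)
    (μ : Fin (m - 1) → (G →L[ℂ] V))
    (hμ : ∀ j, adjoint ν ∘L μ j + adjoint (μ j) ∘L ν = 0) :
    ∀ ζ : EuclideanSpace ℝ (Fin (m - 1)),
      (‖ζ‖ ^ 2 : ℂ) • ContinuousLinearMap.id ℂ V +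
        ((-(ν ∘L adjoint ν ∘L (∑ j, (ζ j : ℂ) • μ j) ∘L adjoint ν)) ∘L
          (-(ν ∘L adjoint ν ∘L (∑ j, (ζ j : ℂ) • μ j) ∘L adjoint ν))) =
      (‖ζ‖ ^ 2 : ℂ) • (ContinuousLinearMap.id ℂ V - ν ∘L adjoint ν) +
        (ν ∘L adjoint ν) ∘L
          ((‖ζ‖ ^ 2 : ℂ) • ContinuousLinearMap.id ℂ V -
            (∑ j, (ζ j : ℂ) • μ j) ∘L adjoint (∑ j, (ζ j : ℂ) • μ j)) ∘L
          (ν ∘L adjoint ν) := by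
  intro ζ
  have hM := adjoint_comp_real_sum_add_eq_zero ν μ hμ ζ
  generalize (∑ j, (ζ j : ℂ) • μ j) = M at hM ⊢
  generalize ((‖ζ‖ : ℂ) ^ 2) = c
  have hνx (x : G) : adjoint ν (ν x) = x := DFunLike.congr_fun hν x
  have hMx (x : G) : adjoint M (ν x) = -adjoint ν (M x) :=
    eq_neg_of_add_eq_zero_right (DFunLike.congr_fun hM x)
  ext x
  simp [hνx, hMx, smul_sub]
  abel
end
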